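/- For all n ≥ 2, the number of permutations π ∈ S_n with θ(π) = π is F_{n+1}; moreover, a permutation π ∈ S_n satisfies θ(π) = π if and only if π is an involution in which every 2-cycle transposes a pair of consecutive integers i and i+1. -/

import Mathlib

/-- The one-line word of the image of `π` under the fundamental bijection:
write `π` in standard cycle form (every cycle written with its largest element
first, cycles listed in increasing order of their largest elements) and erase
the parentheses.  The cycle maxima are exactly the `x` with `π^[k] x ≤ x` for
all `k`, and the cycle of `x` is `x, π x, π² x, …` up to the period of `x`. -/
noncomputable def fundWord {n : ℕ} (π : Equiv.Perm (Fin n)) : List (Fin n) :=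
  ((List.finRange n).filter fun x => (List.range n).all fun k => decide ((⇑π)^[k] x ≤ x)).flatMap
    fun x => (List.range (Function.minimalPeriod (⇑π) x)).map fun k => (⇑π)^[k] x

/-- The permutation whose one-line notation is the word `w`
(junk value if `w` is not the one-line notation of a permutation). -/
noncomputable def permOfWord {n : ℕ} (w : List (Fin n)) : Equiv.Perm (Fin n) :=
  Function.invFun (fun σ : Equiv.Perm (Fin n) => (List.finRange n).map ⇑σ) w

/-- The fundamental bijection `θ`. -/
noncomputable def theta {n : ℕ} (π : Equiv.Perm (Fin n)) : Equiv.Perm (Fin n) :=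
  permOfWord (fundWord π)

/-- `π` contains the pattern `σ`. -/
def Contains {k n : ℕ} (σ : Equiv.Perm (Fin k)) (π : Equiv.Perm (Fin n)) : Prop :=
  ∃ f : Fin k → Fin n, StrictMono f ∧ ∀ a b : Fin k, π (f a) < π (f b) ↔ σ a < σ b

/-- `π` avoids the pattern `σ`. -/
def Avoids {k n : ℕ} (π : Equiv.Perm (Fin n)) (σ : Equiv.Perm (Fin k)) : Prop :=
  ¬ Contains σ π

noncomputable def p123 : Equiv.Perm (Fin 3) := Equiv.ofBijective ![0, 1, 2] (by decide)
noncomputable def p132 : Equiv.Perm (Fin 3) := Equiv.ofBijective ![0, 2, 1] (by decide)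
noncomputable def p213 : Equiv.Perm (Fin 3) := Equiv.ofBijective ![1, 0, 2] (by decide)
noncomputable def p231 : Equiv.Perm (Fin 3) := Equiv.ofBijective ![1, 2, 0] (by decide)
noncomputable def p312 : Equiv.Perm (Fin 3) := Equiv.ofBijective ![2, 0, 1] (by decide)
noncomputable def p321 : Equiv.Perm (Fin 3) := Equiv.ofBijective ![2, 1, 0] (by decide)

/-- The direct sum `π ⊕ τ` of two permutations. -/
def directSum {n m : ℕ} (π : Equiv.Perm (Fin n)) (τ : Equiv.Perm (Fin m)) :
    Equiv.Perm (Fin (n + m)) :=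
  finSumFinEquiv.permCongr (Equiv.sumCongr π τ)

/-- A permutation is irreducible if it is not a direct sum of two nonempty permutations. -/
def IrreduciblePerm {n : ℕ} (π : Equiv.Perm (Fin n)) : Prop :=
  ¬ ∃ (a b : ℕ) (_ : 0 < a) (_ : 0 < b) (h : a + b = n)
      (σ : Equiv.Perm (Fin a)) (τ : Equiv.Perm (Fin b)),
      π = (finCongr h).permCongr (directSum σ τ)

/-- A permutation is cyclic if its cycle decomposition is a single cycle of full length,
i.e. it acts transitively. -/
def IsCyclicPerm {n : ℕ} (π : Equiv.Perm (Fin n)) : Prop :=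
  ∀ x y : Fin n, ∃ k : ℕ, (⇑π)^[k] x = y

open Equiv Function

section Counting

/-- The involutions of `ℕ` fixing every `i ≥ n` and moving every point to itself or a neighbour. -/
def adjacentInvolutions (n : ℕ) : Set (Perm ℕ) :=
  {σ | (∀ i, σ (σ i) = i) ∧ (∀ i, σ i ≠ i → σ i = i + 1 ∨ i = σ i + 1) ∧ ∀ i, n ≤ i → σ i = i}

theorem adjacentInvolutions_eq_singleton {n : ℕ} (hn : n ≤ 1) : adjacentInvolutions n = {1} := by
  ext σ
  simp only [adjacentInvolutions, Set.mem_ofPred_eq, Set.mem_singleton_iff]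
  constructor
  · rintro ⟨h₁, -, h₃⟩
    ext i
    rw [Perm.one_apply]
    by_cases hi : n ≤ i
    · exact h₃ i hi
    · obtain rfl : i = 0 := by omega
      by_contra h0
      have h₄ := h₃ (σ 0) (by omega)
      have h₅ := h₁ 0
      omega
  · rintro rfl
    simp

theorem mul_swap_mem_adjacentInvolutions {n : ℕ} {σ : Perm ℕ} (hσ : σ ∈ adjacentInvolutions n) :
    σ * swap n (n + 1) ∈ adjacentInvolutions (n + 2) := by
  obtain ⟨h₁, h₂, h₃⟩ := hσ
  have hlt : ∀ i, i < n → σ i < n := fun i hi => by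
    by_contra h
    have h₄ := h₃ (σ i) (by omega)
    have h₅ := h₁ i
    omega
  have hn := h₃ n le_rfl
  have hn' := h₃ (n + 1) (by omega)
  refine ⟨fun i => ?_, fun i => ?_, fun i hi => ?_⟩
  · have := hlt i
    have := h₁ i
    have := h₃ i
    simp only [Perm.mul_apply, swap_apply_def]
    grind
  · have := h₂ i
    simp only [Perm.mul_apply, swap_apply_def]
    grind
  · have := h₃ i
    simp only [Perm.mul_apply, swap_apply_def]
    grind

theorem mul_swap_mem_of_apply_ne {n : ℕ} {σ : Perm ℕ} (hσ : σ ∈ adjacentInvolutions (n + 2))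
    (h : σ (n + 1) ≠ n + 1) : σ * swap n (n + 1) ∈ adjacentInvolutions n := by
  obtain ⟨h₁, h₂, h₃⟩ := hσ
  have hn' : σ (n + 1) = n := by
    have := h₂ (n + 1) h
    have := h₃ (n + 2) le_rfl
    have := h₁ (n + 1)
    grind
  have hn : σ n = n + 1 := by rw [← hn', h₁, hn']
  refine ⟨fun i => ?_, fun i => ?_, fun i hi => ?_⟩
  · have := h₁ i
    simp only [Perm.mul_apply, swap_apply_def]
    grind
  · have := h₂ i
    simp only [Perm.mul_apply, swap_apply_def]
    grind
  · have := h₃ i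
    simp only [Perm.mul_apply, swap_apply_def]
    grind

theorem adjacentInvolutions_add_two (n : ℕ) :
    adjacentInvolutions (n + 2) =
      adjacentInvolutions (n + 1) ∪ (· * swap n (n + 1)) '' adjacentInvolutions n := by
  ext σ
  constructor
  · intro hσ
    by_cases h : σ (n + 1) = n + 1
    · refine Or.inl ⟨hσ.1, hσ.2.1, fun i hi => ?_⟩
      rcases hi.eq_or_lt with rfl | hi
      · exact h
      · exact hσ.2.2 i hi
    · exact Or.inr ⟨_, mul_swap_mem_of_apply_ne hσ h, by simp [mul_assoc]⟩
  · rintro (hσ | ⟨τ, hτ, rfl⟩)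
    · exact ⟨hσ.1, hσ.2.1, fun i hi => hσ.2.2 i (by omega)⟩
    · exact mul_swap_mem_adjacentInvolutions hτ

theorem encard_adjacentInvolutions (n : ℕ) :
    (adjacentInvolutions n).encard = Nat.fib (n + 1) := by
  induction n using Nat.twoStepInduction with
  | zero => simp [adjacentInvolutions_eq_singleton]
  | one => simp [adjacentInvolutions_eq_singleton]
  | more n ih₀ ih₁ =>
    rw [adjacentInvolutions_add_two, Set.encard_union_eq, (mul_left_injective _).encard_image,
      ih₀, ih₁, Nat.fib_add_two (n := n + 1), Nat.cast_add, add_comm]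
    rw [Set.disjoint_left]
    rintro _ hσ ⟨τ, hτ, rfl⟩
    have h₁ := hσ.2.2 (n + 1) le_rfl
    have h₂ := hτ.2.2 n le_rfl
    simp only [Perm.mul_apply, swap_apply_right] at h₁
    omega

/-- Involutions of `Fin n` all of whose 2-cycles transpose consecutive elements. -/
def IsAdjacentInvolution {n : ℕ} (π : Perm (Fin n)) : Prop :=
  π * π = 1 ∧ ∀ i : Fin n, π i ≠ i → ((π i : ℕ) = (i : ℕ) + 1 ∨ (i : ℕ) = (π i : ℕ) + 1)

theorem IsAdjacentInvolution.apply_apply {n : ℕ} {π : Perm (Fin n)} (h : IsAdjacentInvolution π)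
    (i : Fin n) : π (π i) = i := by
  simpa using congrArg (· i) h.1

/-- Permutations of `Fin n` as permutations of `ℕ` fixing every `i ≥ n`. -/
def finPermEquiv (n : ℕ) : Perm (Fin n) ≃ {σ : Perm ℕ // ∀ i, ¬ i < n → σ i = i} :=
  (Fin.equivSubtype.permCongr).trans (Perm.subtypeEquivSubtypePerm (· < n))

theorem finPermEquiv_apply_val {n : ℕ} (π : Perm (Fin n)) (i : Fin n) :
    (finPermEquiv n π : Perm ℕ) i = π i := by
  exact Perm.ofSubtype_apply_coe (Fin.equivSubtype.permCongr π) (Fin.equivSubtype i)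

theorem finPermEquiv_mem_adjacentInvolutions {n : ℕ} (π : Perm (Fin n)) :
    (finPermEquiv n π : Perm ℕ) ∈ adjacentInvolutions n ↔ IsAdjacentInvolution π := by
  constructor
  · rintro ⟨h₁, h₂, -⟩
    refine ⟨?_, fun i hi => ?_⟩
    · ext i
      simpa [finPermEquiv_apply_val] using h₁ i
    · have := h₂ i
      rw [finPermEquiv_apply_val] at this
      exact this fun h => hi (Fin.ext h)
  · intro h
    have hfix := (finPermEquiv n π).2
    refine ⟨fun i => ?_, fun i hi => ?_, fun i hi => hfix i (by omega)⟩
    · by_cases hi : i < n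
      · have := finPermEquiv_apply_val π ⟨i, hi⟩
        simp only at this
        rw [this, finPermEquiv_apply_val, h.apply_apply]
      · rw [hfix i hi, hfix i hi]
    · by_cases hin : i < n
      · have := finPermEquiv_apply_val π ⟨i, hin⟩
        simp only at this
        rw [this] at hi ⊢
        exact h.2 ⟨i, hin⟩ fun h' => hi (congrArg Fin.val h')
      · exact absurd (hfix i hin) hi

theorem card_isAdjacentInvolution (n : ℕ) :
    Nat.card {π : Perm (Fin n) // IsAdjacentInvolution π} = Nat.fib (n + 1) := by
  have e : {π : Perm (Fin n) // IsAdjacentInvolution π} ≃ adjacentInvolutions n :=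
    ((finPermEquiv n).subtypeEquiv fun π => (finPermEquiv_mem_adjacentInvolutions π).symm).trans
      (Equiv.subtypeSubtypeEquivSubtype fun {σ} hσ i hi => hσ.2.2 i (not_lt.1 hi))
  rw [Nat.card_congr e, Nat.card_coe_set_eq, Set.ncard, encard_adjacentInvolutions,
    ENat.toNat_natCast]

end Counting

section Word

variable {n : ℕ} {π : Perm (Fin n)}

theorem minimalPeriod_perm_pos (π : Perm (Fin n)) (x : Fin n) :
    0 < minimalPeriod π x :=
  minimalPeriod_pos_of_mem_periodicPts (π.injective.mem_periodicPts x)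

theorem minimalPeriod_le_card (π : Perm (Fin n)) (x : Fin n) : minimalPeriod π x ≤ n := by
  by_contra! h
  have hinj : Injective fun k : Fin (n + 1) => (⇑π)^[k] x := fun a b hab =>
    Fin.ext (iterate_injOn_Iio_minimalPeriod (f := π) (x := x)
      (Set.mem_Iio.2 (by omega)) (Set.mem_Iio.2 (by omega)) hab)
  simpa using Fintype.card_le_of_injective _ hinj

theorem iterate_le_of_forall_lt {x : Fin n} (h : ∀ k < n, (⇑π)^[k] x ≤ x) (k : ℕ) :
    (⇑π)^[k] x ≤ x := by
  rw [← iterate_mod_minimalPeriod_eq]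
  exact h _ ((Nat.mod_lt _ (minimalPeriod_perm_pos π x)).trans_le
    (minimalPeriod_le_card π x))

theorem mem_fundWord (π : Perm (Fin n)) (z : Fin n) : z ∈ fundWord π := by
  obtain ⟨x, ⟨k, rfl⟩, hx⟩ := (Set.range fun k => (⇑π)^[k] z).toFinite.exists_maximal
    (Set.range_nonempty _)
  simp only [fundWord, List.mem_flatMap, List.mem_filter, List.mem_finRange, true_and,
    List.all_eq_true, List.mem_range, decide_eq_true_eq, List.mem_map]
  refine ⟨(⇑π)^[k] z, fun l _ => ?_, ?_⟩
  · rw [← iterate_add_apply]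
    exact not_lt.1 fun h => h.not_ge (hx ⟨l + k, rfl⟩ h.le)
  · set p := minimalPeriod π ((⇑π)^[k] z) with hp
    have hpos : 0 < p := minimalPeriod_perm_pos π _
    refine ⟨(p * k - k) % p, Nat.mod_lt _ hpos, ?_⟩
    rw [iterate_mod_minimalPeriod_eq, ← iterate_add_apply,
      Nat.sub_add_cancel (Nat.le_mul_of_pos_left k hpos)]
    apply (π.injective.iterate k)
    rw [← iterate_add_apply, add_comm, iterate_add_apply]
    exact (isPeriodicPt_minimalPeriod π ((⇑π)^[k] z)).mul_const k

theorem nodup_fundWord (π : Perm (Fin n)) : (fundWord π).Nodup := by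
  rw [fundWord, List.nodup_flatMap]
  constructor
  · intro x _
    refine List.Nodup.map_on (fun a ha b hb hab => ?_) List.nodup_range
    exact iterate_injOn_Iio_minimalPeriod (Set.mem_Iio.2 (List.mem_range.1 ha))
      (Set.mem_Iio.2 (List.mem_range.1 hb)) hab
  · have key : ∀ x y : Fin n, (∀ k < n, (⇑π)^[k] y ≤ y) → ∀ a b, a < minimalPeriod π x →
        (⇑π)^[a] x = (⇑π)^[b] y → x ≤ y := by
      intro x y hy a b ha hab
      have : (⇑π)^[minimalPeriod π x - a + b] y = x := by
        rw [iterate_add_apply, ← hab, ← iterate_add_apply, Nat.sub_add_cancel ha.le,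
          iterate_minimalPeriod]
      exact this ▸ iterate_le_of_forall_lt hy _
    refine ((List.nodup_finRange n).filter _).imp_of_mem ?_
    intro x y hx hy hne z hzx hzy
    simp only [List.mem_filter, List.mem_finRange, true_and, List.all_eq_true, List.mem_range,
      decide_eq_true_eq, List.mem_map] at hx hy hzx hzy
    obtain ⟨a, ha, rfl⟩ := hzx
    obtain ⟨b, hb, hab⟩ := hzy
    exact hne (le_antisymm (key x y hy a b ha hab.symm) (key y x hx b a hb hab))

theorem exists_map_finRange_eq {w : List (Fin n)} (hw : w.Nodup) (hmem : ∀ x, x ∈ w) :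
    ∃ σ : Perm (Fin n), (List.finRange n).map σ = w := by
  classical
  let e := hw.getEquivOfForallMemList w hmem
  have hlen : n = w.length := by simpa using (Fintype.card_congr e).symm
  refine ⟨(finCongr hlen).trans e, List.ext_get (by simpa using hlen) fun i h₁ h₂ => ?_⟩
  simp [e]

theorem theta_eq_self_iff_fundWord_eq : theta π = π ↔ fundWord π = (List.finRange n).map π := by
  have hinj : Injective fun σ : Perm (Fin n) => (List.finRange n).map σ := fun σ τ h => by
    ext1 i
    exact List.map_inj_left.1 h i (List.mem_finRange i)
  constructor
  · intro h
    have := invFun_eq (f := fun σ : Perm (Fin n) => (List.finRange n).map σ)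
      (exists_map_finRange_eq (nodup_fundWord π) (mem_fundWord π))
    rw [← this]
    exact congrArg (fun σ : Perm (Fin n) => (List.finRange n).map σ) h
  · intro h
    rw [theta, h]
    exact leftInverse_invFun hinj π

/-- The cycle of `x`, written starting from `x`. -/
noncomputable def cycleWord (π : Perm (Fin n)) (x : Fin n) : List (Fin n) :=
  (List.range (minimalPeriod π x)).map fun k => (⇑π)^[k] x

theorem cycleWord_of_fixed {x : Fin n} (h : π x = x) : cycleWord π x = [x] := by
  simp [cycleWord, minimalPeriod_eq_one_iff_isFixedPt.2 h]

theorem minimalPeriod_eq_two {x : Fin n} (hne : π x ≠ x) (h : π (π x) = x) :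
    minimalPeriod π x = 2 :=
  minimalPeriod_eq_prime (p := 2) h hne

theorem cycleWord_of_involutive {x : Fin n} (hne : π x ≠ x) (h : π (π x) = x) :
    cycleWord π x = [x, π x] := by
  simp [cycleWord, minimalPeriod_eq_two hne h, List.range_succ]

theorem cycleWord_of_ne {x : Fin n} (hne : π x ≠ x) :
    ∃ l, cycleWord π x = x :: π x :: l := by
  obtain ⟨m, hm⟩ : ∃ m, minimalPeriod π x = m + 2 := by
    have h₀ := minimalPeriod_perm_pos π x
    have h₁ : minimalPeriod π x ≠ 1 := fun h => hne (minimalPeriod_eq_one_iff_isFixedPt.1 h)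
    exact ⟨minimalPeriod π x - 2, by omega⟩
  rw [cycleWord, hm, List.range_succ_eq_map, List.range_succ_eq_map]
  simp

theorem finRange_drop_eq_cons {j : ℕ} (hj : j < n) :
    (List.finRange n).drop j = ⟨j, hj⟩ :: (List.finRange n).drop (j + 1) := by
  rw [List.drop_eq_getElem_cons (by simpa using hj)]
  simp

/-- `π` preserves `{i | i < j}` and restricts to an adjacent involution of it. -/
def IsAdjacentInvolutionBelow (π : Perm (Fin n)) (j : ℕ) : Prop :=
  ∀ i : Fin n, (i : ℕ) < j → (π i : ℕ) < j ∧ π (π i) = i ∧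
    (π i ≠ i → ((π i : ℕ) = (i : ℕ) + 1 ∨ (i : ℕ) = (π i : ℕ) + 1))

theorem IsAdjacentInvolutionBelow.le_apply {j : ℕ} (h : IsAdjacentInvolutionBelow π j)
    {i : Fin n} (hi : j ≤ i) : j ≤ (π i : ℕ) := by
  by_contra! hlt
  obtain ⟨h₁, h₂, -⟩ := h _ hlt
  rw [π.injective h₂] at h₁
  omega

theorem IsAdjacentInvolutionBelow.isAdjacentInvolution (h : IsAdjacentInvolutionBelow π n) :
    IsAdjacentInvolution π :=
  ⟨Equiv.ext fun i => (h i i.2).2.1, fun i => (h i i.2).2.2⟩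

theorem isAdjacentInvolution_of_flatMap_cycleWord_eq (M : List (Fin n)) (j : ℕ) (hjn : j ≤ n)
    (hM : ∀ c ∈ M, π c ≤ c) (hw : M.flatMap (cycleWord π) = ((List.finRange n).drop j).map π)
    (hj : IsAdjacentInvolutionBelow π j) : IsAdjacentInvolution π := by
  induction M generalizing j with
  | nil =>
    have := congrArg List.length hw
    simp only [List.flatMap_nil, List.length_nil, List.length_map, List.length_drop,
      List.length_finRange] at this
    obtain rfl : j = n := by omega
    exact hj.isAdjacentInvolution
  | cons c M ih =>
    have hM' : ∀ c ∈ M, π c ≤ c := fun d hd => hM d (List.mem_cons_of_mem _ hd)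
    rw [List.flatMap_cons] at hw
    by_cases hc : π c = c
    · rw [cycleWord_of_fixed hc] at hw
      have hlt : j < n := by
        by_contra hge
        simp [List.drop_eq_nil_of_le (as := List.finRange n) (i := j) (by simpa using hge)] at hw
      rw [finRange_drop_eq_cons hlt, List.map_cons, List.singleton_append, List.cons.injEq] at hw
      obtain ⟨h₁, h₂⟩ := hw
      have hcj : c = ⟨j, hlt⟩ := π.injective (hc.trans h₁)
      subst hcj
      refine ih (j + 1) hlt hM' h₂ fun i hi => ?_
      rcases (Nat.lt_succ_iff_lt_or_eq.1 hi) with hi | hi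
      · have := hj i hi
        exact ⟨by omega, this.2⟩
      · obtain rfl : i = ⟨j, hlt⟩ := Fin.ext hi
        simp [hc]
    · obtain ⟨l, hl⟩ := cycleWord_of_ne hc
      have hlt : j + 1 < n := by
        have := congrArg List.length hw
        simp [hl] at this
        omega
      have hw' := hw
      rw [hl, finRange_drop_eq_cons (by omega), finRange_drop_eq_cons hlt] at hw'
      simp only [List.map_cons, List.cons_append, List.cons.injEq] at hw'
      obtain ⟨h₁, h₂, -⟩ := hw'
      have hcj : c = ⟨j + 1, hlt⟩ := π.injective h₂
      have hle : (π c : ℕ) ≤ c := hM c (List.mem_cons_self ..)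
      have hge := hj.le_apply (i := c) (by simp [hcj])
      have hne : (π c : ℕ) ≠ c := fun h => hc (Fin.ext h)
      have hcv : (c : ℕ) = j + 1 := by simp [hcj]
      have hπc : π c = ⟨j, by omega⟩ := Fin.ext (by simp only; omega)
      have hcc : π (π c) = c := by rw [hπc, ← h₁]
      rw [cycleWord_of_involutive hc hcc, finRange_drop_eq_cons (by omega),
        finRange_drop_eq_cons hlt] at hw
      simp only [List.map_cons, List.cons_append, List.nil_append, List.cons.injEq] at hw
      refine ih (j + 2) hlt hM' hw.2.2 fun i hi => ?_
      obtain hi | hi | hi : (i : ℕ) < j ∨ (i : ℕ) = j ∨ (i : ℕ) = j + 1 := by omega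
      · have := hj i hi
        exact ⟨by omega, this.2⟩
      · obtain rfl : i = π c := by rw [hπc]; exact Fin.ext hi
        rw [hcc]
        exact ⟨by omega, rfl, fun _ => by omega⟩
      · obtain rfl : i = c := Fin.ext (by omega)
        exact ⟨by rw [hπc]; simp, hcc, fun _ => by rw [hπc]; simp only; omega⟩

theorem all_iterate_le_eq_apply_le (hn : 2 ≤ n) (h : IsAdjacentInvolution π) (x : Fin n) :
    ((List.range n).all fun k => decide ((⇑π)^[k] x ≤ x)) = decide (π x ≤ x) := by
  rw [Bool.eq_iff_iff]
  simp only [List.all_eq_true, List.mem_range, decide_eq_true_eq]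
  refine ⟨fun h' => h' 1 hn, fun hx k _ => ?_⟩
  have hinv : Involutive π := h.apply_apply
  rcases Nat.even_or_odd k with hk | hk
  · simp [hinv.iterate_even hk]
  · simpa [hinv.iterate_odd hk] using hx

theorem IsAdjacentInvolution.flatMap_filter_drop_eq (h : IsAdjacentInvolution π) (j : ℕ)
    (hj : ∀ i : Fin n, j ≤ i → j ≤ (π i : ℕ)) :
    (((List.finRange n).drop j).filter fun x => decide (π x ≤ x)).flatMap (cycleWord π) =
      ((List.finRange n).drop j).map π := by
  induction hm : n - j using Nat.strong_induction_on generalizing j with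
  | _ m ih =>
    by_cases hjn : n ≤ j
    · rw [List.drop_eq_nil_of_le (by simpa using hjn)]
      simp
    push Not at hjn
    by_cases hfix : π ⟨j, hjn⟩ = ⟨j, hjn⟩
    · have hrec := ih (n - (j + 1)) (by omega) (j + 1) (fun i hi => by
        have h₁ := hj i (by omega)
        have h₂ : (π i : ℕ) ≠ j := fun h₂ => by
          have : π i = π ⟨j, hjn⟩ := by rw [hfix]; exact Fin.ext h₂
          have := congrArg Fin.val (π.injective this)
          simp only at this
          omega
        omega) rfl
      rw [finRange_drop_eq_cons hjn, List.filter_cons_of_pos (by simp [hfix]), List.flatMap_cons,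
        hrec, cycleWord_of_fixed hfix, List.map_cons, hfix, List.singleton_append]
    · have hval : (π ⟨j, hjn⟩ : ℕ) = j + 1 := by
        have h₁ := h.2 _ hfix
        have h₂ := hj ⟨j, hjn⟩ le_rfl
        simp only at h₁
        omega
      have hlt : j + 1 < n := hval ▸ (π ⟨j, hjn⟩).2
      have hπ : π ⟨j, hjn⟩ = ⟨j + 1, hlt⟩ := Fin.ext hval
      have hπ' : π ⟨j + 1, hlt⟩ = ⟨j, hjn⟩ := by rw [← hπ, h.apply_apply]
      have hrec := ih (n - (j + 2)) (by omega) (j + 2) (fun i hi => by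
        have h₁ := hj i (by omega)
        have h₂ : (π i : ℕ) ≠ j := fun h₂ => by
          have : π i = π ⟨j + 1, hlt⟩ := by rw [hπ']; exact Fin.ext h₂
          have := congrArg Fin.val (π.injective this)
          simp only at this
          omega
        have h₃ : (π i : ℕ) ≠ j + 1 := fun h₃ => by
          have : π i = π ⟨j, hjn⟩ := by rw [hπ]; exact Fin.ext h₃
          have := congrArg Fin.val (π.injective this)
          simp only at this
          omega
        omega) rfl
      rw [finRange_drop_eq_cons hjn, finRange_drop_eq_cons hlt,
        List.filter_cons_of_neg (by simp [hπ]), List.filter_cons_of_pos (by simp [hπ']),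
        List.flatMap_cons, hrec, cycleWord_of_involutive (by simp [hπ']) (h.apply_apply _),
        List.map_cons, List.map_cons, hπ, hπ']
      rfl

theorem theta_eq_self_iff_isAdjacentInvolution (hn : 2 ≤ n) :
    theta π = π ↔ IsAdjacentInvolution π := by
  rw [theta_eq_self_iff_fundWord_eq]
  constructor
  · intro h
    refine isAdjacentInvolution_of_flatMap_cycleWord_eq _ 0 (Nat.zero_le n) (fun c hc => ?_) h
      fun i hi => absurd hi (Nat.not_lt_zero _)
    simp only [List.mem_filter, List.all_eq_true, List.mem_range, decide_eq_true_eq] at hc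
    exact hc.2 1 hn
  · intro h
    simp only [fundWord, all_iterate_le_eq_apply_le hn h]
    exact h.flatMap_filter_drop_eq 0 fun _ _ => Nat.zero_le _

end Word

/-- for `n ≥ 2` there are `F_{n+1}` permutations fixed by `θ`, and they
are exactly the involutions all of whose 2-cycles transpose consecutive integers. -/
theorem fixed_theta (n : ℕ) (hn : 2 ≤ n) :
    Nat.card {π : Equiv.Perm (Fin n) // theta π = π} = Nat.fib (n + 1) ∧
    ∀ π : Equiv.Perm (Fin n), theta π = π ↔
      (π * π = 1 ∧ ∀ i : Fin n, π i ≠ i →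
        ((π i : ℕ) = (i : ℕ) + 1 ∨ (i : ℕ) = (π i : ℕ) + 1)) := by
  refine ⟨?_, fun π => theta_eq_self_iff_isAdjacentInvolution hn⟩
  rw [← card_isAdjacentInvolution]
  exact Nat.card_congr
    (Equiv.subtypeEquivRight fun π => theta_eq_self_iff_isAdjacentInvolution hn)
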